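/- arXiv:1301.3425 — 5 statements merged into one kernel-verified Lean document; each statement's English description precedes it below -/
import Mathlib

section
/- Let φ₁, φ₂ : ℝ → ℝ be any functions and define F : ℝ² → ℝ² by F(x,y) = (y·φ₁(y²−x²) + x·φ₂(y²−x²), x·φ₁(y²−x²) + y·φ₂(y²−x²)). Then F is equivariant under every Lorentz transformation of the plane: for all α ∈ ℝ and all (x,y) ∈ ℝ², F(x cosh α + y sinh α, x sinh α + y cosh α) = (F₁(x,y) cosh α + F₂(x,y) sinh α, F₁(x,y) sinh α + F₂(x,y) cosh α). -/
/-- The planar vector field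
`F(x,y) = (y φ₁(y²−x²) + x φ₂(y²−x²), x φ₁(y²−x²) + y φ₂(y²−x²))`
is equivariant under every Lorentz transformation of the plane. -/
theorem statement_6 (φ₁ φ₂ : ℝ → ℝ)
    (F : ℝ × ℝ → ℝ × ℝ)
    (hF : ∀ x y : ℝ, F (x, y) =
      (y * φ₁ (y ^ 2 - x ^ 2) + x * φ₂ (y ^ 2 - x ^ 2),
        x * φ₁ (y ^ 2 - x ^ 2) + y * φ₂ (y ^ 2 - x ^ 2)))
    (α x y : ℝ) :
    F (x * Real.cosh α + y * Real.sinh α, x * Real.sinh α + y * Real.cosh α)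
      = ((F (x, y)).1 * Real.cosh α + (F (x, y)).2 * Real.sinh α,
         (F (x, y)).1 * Real.sinh α + (F (x, y)).2 * Real.cosh α) := by
  have h : (x * Real.sinh α + y * Real.cosh α) ^ 2 - (x * Real.cosh α + y * Real.sinh α) ^ 2
      = y ^ 2 - x ^ 2 := by
    linear_combination (y ^ 2 - x ^ 2) * Real.cosh_sq_sub_sinh_sq α
  rw [hF, hF, h]
  ext <;> ring
end

section
/- Let D = {(x,y) ∈ ℝ² : y > |x|} and let F : D → ℝ² be any function that is Lorentz-equivariant on D: for all α ∈ ℝ and all (x,y) ∈ D (note that D is invariant under Lorentz transformations), F(x cosh α + y sinh α, x sinh α + y cosh α) = (F₁(x,y) cosh α + F₂(x,y) sinh α, F₁(x,y) sinh α + F₂(x,y) cosh α). Then there exist functions φ₁, φ₂ : ℝ → ℝ such that for all (x,y) ∈ D: F₁(x,y) = y·φ₁(y²−x²) + x·φ₂(y²−x²) and F₂(x,y) = x·φ₁(y²−x²) + y·φ₂(y²−x²). -/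
/-- A planar vector field on `D = {(x,y) : y > |x|}` that is
Lorentz-equivariant has the form
`F = (y φ₁(y²−x²) + x φ₂(y²−x²), x φ₁(y²−x²) + y φ₂(y²−x²))` on `D`. -/
theorem statement_7 (F : ℝ × ℝ → ℝ × ℝ)
    (hF : ∀ (α x y : ℝ), |x| < y →
      F (x * Real.cosh α + y * Real.sinh α, x * Real.sinh α + y * Real.cosh α)
        = ((F (x, y)).1 * Real.cosh α + (F (x, y)).2 * Real.sinh α,
           (F (x, y)).1 * Real.sinh α + (F (x, y)).2 * Real.cosh α)) :
    ∃ φ₁ φ₂ : ℝ → ℝ, ∀ x y : ℝ, |x| < y →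
      (F (x, y)).1 = y * φ₁ (y ^ 2 - x ^ 2) + x * φ₂ (y ^ 2 - x ^ 2) ∧
      (F (x, y)).2 = x * φ₁ (y ^ 2 - x ^ 2) + y * φ₂ (y ^ 2 - x ^ 2) := by
  refine ⟨fun t => (F (0, √t)).1 / √t, fun t => (F (0, √t)).2 / √t, fun x y hxy => ?_⟩
  have hpos : 0 < y ^ 2 - x ^ 2 := sub_pos.2 (sq_lt_sq.2 (hxy.trans_le (le_abs_self y)))
  have hy : 0 < y := (abs_nonneg x).trans_lt hxy
  have hr : 0 < √(y ^ 2 - x ^ 2) := Real.sqrt_pos.2 hpos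
  have hr2 : √(y ^ 2 - x ^ 2) ^ 2 = y ^ 2 - x ^ 2 := Real.sq_sqrt hpos.le
  beta_reduce
  generalize √(y ^ 2 - x ^ 2) = r at hr hr2 ⊢
  have hsinh : Real.sinh (Real.arsinh (x / r)) = x / r := Real.sinh_arsinh _
  have hcosh : Real.cosh (Real.arsinh (x / r)) = y / r := by
    rw [Real.cosh_arsinh, Real.sqrt_eq_iff_mul_self_eq_of_pos (div_pos hy hr)]
    field_simp
    linarith
  have h := hF (Real.arsinh (x / r)) 0 r (by simpa using hr)
  rw [hsinh, hcosh, zero_mul, zero_mul, zero_add, zero_add, mul_div_cancel₀ x hr.ne',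
    mul_div_cancel₀ y hr.ne'] at h
  rw [h]
  constructor <;> ring
end

section
/- Let D = {(x,y) ∈ ℝ² : x > 0 and y > 0} and let F : D → ℝ² be any function satisfying, for every α ∈ ℝ and every (x,y) ∈ D with 1 − αx > 0: F₁(x/(1−αx), y/(1−αx)) = F₁(x,y)/(1−αx)² and F₂(x/(1−αx), y/(1−αx)) = α·y·F₁(x,y)/(1−αx)² + F₂(x,y)/(1−αx). Then there exist functions φ₁, φ₂ : ℝ → ℝ such that for all (x,y) ∈ D: F₁(x,y) = x²·φ₁(x/y) + xy·φ₂(x/y) and F₂(x,y) = xy·φ₁(x/y) + (x + y²)·φ₂(x/y). -/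
/-- A vector field on `D = {(x,y) : x > 0, y > 0}` that is equivariant under
the one-parameter group of projective transformations `T_α(x,y) = (x/(1−αx), y/(1−αx))`
(for `1 − αx > 0`) has the form
`F₁ = x² φ₁(x/y) + xy φ₂(x/y)`, `F₂ = xy φ₁(x/y) + (x+y²) φ₂(x/y)` on `D`. -/
theorem statement_9 (F : ℝ × ℝ → ℝ × ℝ)
    (hF : ∀ (α x y : ℝ), 0 < x → 0 < y → 0 < 1 - α * x →
      (F (x / (1 - α * x), y / (1 - α * x))).1 = (F (x, y)).1 / (1 - α * x) ^ 2 ∧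
      (F (x / (1 - α * x), y / (1 - α * x))).2 =
        α * y * (F (x, y)).1 / (1 - α * x) ^ 2 + (F (x, y)).2 / (1 - α * x)) :
    ∃ φ₁ φ₂ : ℝ → ℝ, ∀ x y : ℝ, 0 < x → 0 < y →
      (F (x, y)).1 = x ^ 2 * φ₁ (x / y) + x * y * φ₂ (x / y) ∧
      (F (x, y)).2 = x * y * φ₁ (x / y) + (x + y ^ 2) * φ₂ (x / y) := by
  refine ⟨fun r => (F (1, r⁻¹)).1 - r⁻¹ * ((F (1, r⁻¹)).2 - r⁻¹ * (F (1, r⁻¹)).1),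
    fun r => (F (1, r⁻¹)).2 - r⁻¹ * (F (1, r⁻¹)).1, fun x y hx hy => ?_⟩
  have hs : 1 - (1 - x⁻¹) * 1 = x⁻¹ := by ring
  have h := hF (1 - x⁻¹) 1 (y / x) one_pos (div_pos hy hx) (by rw [hs]; positivity)
  have hpx : 1 / x⁻¹ = x := by simp
  have hpy : y / x / x⁻¹ = y := by field_simp
  rw [hs, hpx, hpy] at h
  simp only [inv_div]
  rw [h.1, h.2]
  constructor
  · field_simp
    ring
  · field_simp
    ring
end

section
/- Let k ∈ ℝ with k² ≠ 1, let D = {(x,y) ∈ ℝ² : x > 0 and y ≠ 0}, and let F : D → ℝ² be any function satisfying, for every α ∈ ℝ and every (x,y) ∈ D: F₁(e^α x, e^{kα} y) = e^α·F₁(x,y) and F₂(e^α x, e^{kα} y) = e^{kα}·F₂(x,y). Then there exist functions φ₁, φ₂ : ℝ → ℝ such that for all (x,y) ∈ D: F₁(x,y) = x·φ₁(x^k/y) + k·x·φ₂(x^k/y) and F₂(x,y) = k·y·φ₁(x^k/y) + y·φ₂(x^k/y), where x^k denotes the real power of the positive real x. -/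
/-- Let `k² ≠ 1`. A vector field on `D = {(x,y) : x > 0, y ≠ 0}` that is
equivariant under the one-parameter group of nonhomogeneous stretches
`S_α(x,y) = (e^α x, e^{kα} y)` has the form
`F₁ = x φ₁(x^k/y) + kx φ₂(x^k/y)`, `F₂ = ky φ₁(x^k/y) + y φ₂(x^k/y)` on `D`. -/
theorem statement_12 (k : ℝ) (hk : k ^ 2 ≠ 1)
    (F : ℝ × ℝ → ℝ × ℝ)
    (hF : ∀ (α x y : ℝ), 0 < x → y ≠ 0 →
      (F (Real.exp α * x, Real.exp (k * α) * y)).1 = Real.exp α * (F (x, y)).1 ∧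
      (F (Real.exp α * x, Real.exp (k * α) * y)).2 = Real.exp (k * α) * (F (x, y)).2) :
    ∃ φ₁ φ₂ : ℝ → ℝ, ∀ x y : ℝ, 0 < x → y ≠ 0 →
      (F (x, y)).1 = x * φ₁ (x ^ k / y) + k * x * φ₂ (x ^ k / y) ∧
      (F (x, y)).2 = k * y * φ₁ (x ^ k / y) + y * φ₂ (x ^ k / y) := by
  have hd : 1 - k ^ 2 ≠ 0 := sub_ne_zero.mpr hk.symm
  -- The orbit through `(x, y)` meets `{x = 1}` at `(1, u⁻¹)`, where `u = x ^ k / y`.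
  refine ⟨fun u => ((F (1, u⁻¹)).1 - k * (u * (F (1, u⁻¹)).2)) / (1 - k ^ 2),
    fun u => (u * (F (1, u⁻¹)).2 - k * (F (1, u⁻¹)).1) / (1 - k ^ 2), fun x y hx hy => ?_⟩
  have hxk : x ^ k ≠ 0 := (Real.rpow_pos_of_pos hx k).ne'
  have hexp : Real.exp (k * Real.log x) = x ^ k := by
    rw [Real.rpow_def_of_pos hx, mul_comm]
  obtain ⟨h₁, h₂⟩ := hF (Real.log x) 1 (x ^ k / y)⁻¹ one_pos (inv_ne_zero (div_ne_zero hxk hy))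
  have hy' : x ^ k * (x ^ k / y)⁻¹ = y := by field_simp
  rw [hexp, Real.exp_log hx, mul_one, hy'] at h₁ h₂
  rw [h₁, h₂]
  constructor <;> field_simp <;> ring
end

section
/- Let D = {(x,y) ∈ ℝ² : y ≠ 0} and let F : D → ℝ² be any function satisfying, for every α ∈ ℝ and every (x,y) ∈ D: F₁(x + αy, y) = F₁(x,y) + α·F₂(x,y) and F₂(x + αy, y) = F₂(x,y). Then there exist functions φ₁, φ₂ : ℝ → ℝ such that for all (x,y) ∈ D: F₁(x,y) = y·φ₁(y) + x·φ₂(y) and F₂(x,y) = y·φ₂(y). -/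
/-- A vector field on `D = {(x,y) : y ≠ 0}` that is equivariant under the
one-parameter group of Galilean transformations `G_α(x,y) = (x + αy, y)` has the form
`F₁ = y φ₁(y) + x φ₂(y)`, `F₂ = y φ₂(y)` on `D`. -/
theorem statement_14 (F : ℝ × ℝ → ℝ × ℝ)
    (hF : ∀ (α x y : ℝ), y ≠ 0 →
      (F (x + α * y, y)).1 = (F (x, y)).1 + α * (F (x, y)).2 ∧
      (F (x + α * y, y)).2 = (F (x, y)).2) :
    ∃ φ₁ φ₂ : ℝ → ℝ, ∀ x y : ℝ, y ≠ 0 →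
      (F (x, y)).1 = y * φ₁ y + x * φ₂ y ∧
      (F (x, y)).2 = y * φ₂ y := by
  refine ⟨fun y => (F (0, y)).1 / y, fun y => (F (0, y)).2 / y, fun x y hy => ?_⟩
  obtain ⟨h₁, h₂⟩ := hF (x / y) 0 y hy
  rw [zero_add, div_mul_cancel₀ x hy] at h₁ h₂
  rw [h₁, h₂]
  constructor <;> field_simp
end
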